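/- arXiv:1901.10082 — 2 statements merged into one kernel-verified Lean document; each statement's English description precedes it below -/
import Mathlib

section
/- (Theorem 3.2: monotonicity of Algorithm 1.) Let x_0 ∈ ℝ^d and define x_{k+1} = E_{X∼q_{x_k,τ}}[X] = ∫_{ℝ^d} x' q_{x_k,τ}(x') dx' for k = 0, …, K−1 (all expectations assumed to exist, and all quantities ∫ f q_{x_k,τ} and D_KL(q_{x_k,τ}‖φ_{x,τ}) assumed finite). Then the local entropy decreases monotonically along the iterates: F_τ(x_k) ≤ F_τ(x_{k−1}) for all 1 ≤ k ≤ K. -/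
open MeasureTheory Real

/-- Gaussian density on `ℝ^d` with mean `x` and covariance `τ I`. -/
noncomputable def phi (d : ℕ) (τ : ℝ) (x x' : EuclideanSpace ℝ (Fin d)) : ℝ :=
  (2 * π * τ) ^ (-(d : ℝ) / 2) * Real.exp (-‖x' - x‖ ^ 2 / (2 * τ))

/-- Kullback–Leibler divergence `∫ p log (p / q)` between densities on `ℝ^d`. -/
noncomputable def KL (d : ℕ) (p q : EuclideanSpace ℝ (Fin d) → ℝ) : ℝ :=
  ∫ y, p y * Real.log (p y / q y)

/-- Normalizing constant `Z_{x,τ} = ∫ exp (-f) φ_{x,τ}`. -/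
noncomputable def Z (d : ℕ) (τ : ℝ) (f : EuclideanSpace ℝ (Fin d) → ℝ)
    (x : EuclideanSpace ℝ (Fin d)) : ℝ :=
  ∫ x', Real.exp (-f x') * phi d τ x x'

/-- The density `q_{x,τ} = Z_{x,τ}⁻¹ exp (-f) φ_{x,τ}`. -/
noncomputable def qdens (d : ℕ) (τ : ℝ) (f : EuclideanSpace ℝ (Fin d) → ℝ)
    (x x' : EuclideanSpace ℝ (Fin d)) : ℝ :=
  (Z d τ f x)⁻¹ * (Real.exp (-f x') * phi d τ x x')

/-- Affine lower bound for the Gaussian density as a function of its mean. -/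
lemma phi_mul_one_add_le (d : ℕ) {τ : ℝ} (hτ : 0 < τ) (a b y : EuclideanSpace ℝ (Fin d)) :
    phi d τ a y * (1 + (2 * inner ℝ (b - a) y + ‖a‖ ^ 2 - ‖b‖ ^ 2) / (2 * τ)) ≤ phi d τ b y := by
  have hexp : -‖y - b‖ ^ 2 / (2 * τ) = -‖y - a‖ ^ 2 / (2 * τ) +
      (2 * inner ℝ (b - a) y + ‖a‖ ^ 2 - ‖b‖ ^ 2) / (2 * τ) := by
    rw [← add_div, norm_sub_sq_real, norm_sub_sq_real, inner_sub_left, real_inner_comm y b,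
      real_inner_comm y a]
    ring
  unfold phi
  rw [hexp, Real.exp_add, ← mul_assoc]
  refine mul_le_mul_of_nonneg_left ?_ (by positivity)
  linarith [Real.add_one_le_exp ((2 * inner ℝ (b - a) y + ‖a‖ ^ 2 - ‖b‖ ^ 2) / (2 * τ))]

/-- Moving the center to the mean of `q_{a,τ}` does not decrease the normalizing constant. -/
lemma Z_le_Z_integral_qdens (d : ℕ) {τ : ℝ} (hτ : 0 < τ) (f : EuclideanSpace ℝ (Fin d) → ℝ)
    (hZint : ∀ y, Integrable (fun x' => Real.exp (-f x') * phi d τ y x'))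
    (a : EuclideanSpace ℝ (Fin d)) (hZpos : 0 < Z d τ f a)
    (hmean : Integrable (fun x' => qdens d τ f a x' • x')) :
    Z d τ f a ≤ Z d τ f (∫ x', qdens d τ f a x' • x') := by
  set b := ∫ x', qdens d τ f a x' • x' with hb
  set c := 1 + (‖a‖ ^ 2 - ‖b‖ ^ 2) / (2 * τ) with hc
  have hinner : ∫ y, inner ℝ (b - a) (qdens d τ f a y • y) = inner ℝ (b - a) b :=
    integral_inner hmean (b - a)
  have hpoint : ∀ y, (Real.exp (-f y) * phi d τ a y) * c +
      Z d τ f a / τ * inner ℝ (b - a) (qdens d τ f a y • y) =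
      Real.exp (-f y) * (phi d τ a y *
        (1 + (2 * inner ℝ (b - a) y + ‖a‖ ^ 2 - ‖b‖ ^ 2) / (2 * τ))) := by
    intro y
    rw [inner_smul_right, qdens, hc]
    field_simp
    ring
  have hint₁ := (hZint a).mul_const c
  have hint₂ := (hmean.const_inner (𝕜 := ℝ) (b - a)).const_mul (Z d τ f a / τ)
  have hle : ∫ y, ((Real.exp (-f y) * phi d τ a y) * c +
      Z d τ f a / τ * inner ℝ (b - a) (qdens d τ f a y • y)) ≤ Z d τ f b := by
    refine integral_mono (hint₁.add hint₂) (hZint b) fun y => ?_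
    exact (hpoint y).trans_le
      (mul_le_mul_of_nonneg_left (phi_mul_one_add_le d hτ a b y) (Real.exp_pos _).le)
  rw [integral_add hint₁ hint₂, integral_mul_const, integral_const_mul, hinner] at hle
  change Z d τ f a * c + _ ≤ _ at hle
  have hsq : Z d τ f a * c + Z d τ f a / τ * inner ℝ (b - a) b =
      Z d τ f a + Z d τ f a * ‖b - a‖ ^ 2 / (2 * τ) := by
    rw [hc, norm_sub_sq_real, inner_sub_left, real_inner_self_eq_norm_sq, real_inner_comm b a]
    field_simp
    ring
  have hnonneg : 0 ≤ Z d τ f a * ‖b - a‖ ^ 2 / (2 * τ) := by positivity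
  linarith

theorem stmt7 (d : ℕ) (τ : ℝ) (hτ : 0 < τ)
    (f : EuclideanSpace ℝ (Fin d) → ℝ) (hf : Measurable f) (hfb : ∃ C, ∀ y, C ≤ f y)
    (hZint : ∀ y, Integrable (fun x' => Real.exp (-f x') * phi d τ y x'))
    (hZpos : ∀ y, 0 < Z d τ f y)
    (K : ℕ) (x : ℕ → EuclideanSpace ℝ (Fin d))
    (hmean : ∀ k < K, Integrable (fun x' => qdens d τ f (x k) x' • x'))
    (hupd : ∀ k < K, x (k + 1) = ∫ x', qdens d τ f (x k) x' • x')
    (hfq : ∀ k ≤ K, Integrable (fun y => f y * qdens d τ f (x k) y))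
    (hKL : ∀ k ≤ K, ∀ y, Integrable
      (fun z => qdens d τ f (x k) z * Real.log (qdens d τ f (x k) z / phi d τ y z))) :
    ∀ k, 1 ≤ k → k ≤ K →
      -Real.log (Z d τ f (x k)) ≤ -Real.log (Z d τ f (x (k - 1))) := by
  intro k hk hkK
  obtain ⟨j, rfl⟩ := Nat.exists_eq_add_of_le' hk
  have hjK : j < K := hkK
  rw [Nat.add_sub_cancel, hupd j hjK]
  exact neg_le_neg (Real.log_le_log (hZpos _)
    (Z_le_Z_integral_qdens d hτ f hZint (x j) (hZpos _) (hmean j hjK)))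
end

section
/- (Majorization property for heat regularization.) Define A^H(x, x̃) = log(∫_{ℝ^d} exp(f(x')) q_{x̃,τ}(x') dx') + D_KL(φ_{x,τ}‖q_{x̃,τ}). Then for all x, x̃ ∈ ℝ^d for which these quantities are defined and finite, A^H(x, x̃) ≥ F^H_τ(x), and A^H(x, x) = F^H_τ(x); that is, A^H is a majorizer of the heat-regularized loss F^H_τ. -/
open MeasureTheory Real

theorem phi_pos (d : ℕ) {τ : ℝ} (hτ : 0 < τ) (x y : EuclideanSpace ℝ (Fin d)) :
    0 < phi d τ x y := by
  unfold phi
  positivity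

theorem integral_phi (d : ℕ) {τ : ℝ} (hτ : 0 < τ) (x : EuclideanSpace ℝ (Fin d)) :
    ∫ y, phi d τ x y = 1 := by
  have hb : (0 : ℝ) < 1 / (2 * τ) := by positivity
  have key := GaussianFourier.integral_rexp_neg_mul_sq_norm
    (V := EuclideanSpace ℝ (Fin d)) hb
  have hpi : π / (1 / (2 * τ)) = 2 * π * τ := by field_simp
  rw [finrank_euclideanSpace_fin, hpi] at key
  have hexp : ∀ v : ℝ, -v / (2 * τ) = -(1 / (2 * τ)) * v := fun v => by ring
  simp only [phi, hexp]
  rw [integral_const_mul,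
    integral_sub_right_eq_self
      (fun v : EuclideanSpace ℝ (Fin d) => Real.exp (-(1 / (2 * τ)) * ‖v‖ ^ 2)) x,
    key, ← Real.rpow_add (by positivity)]
  ring_nf
  exact Real.rpow_zero _

theorem integrable_phi (d : ℕ) {τ : ℝ} (hτ : 0 < τ) (x : EuclideanSpace ℝ (Fin d)) :
    Integrable (phi d τ x) :=
  .of_integral_ne_zero (by simp [integral_phi d hτ x])

theorem exp_mul_qdens (d : ℕ) (τ : ℝ) (f : EuclideanSpace ℝ (Fin d) → ℝ)
    (x y : EuclideanSpace ℝ (Fin d)) :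
    Real.exp (f y) * qdens d τ f x y = (Z d τ f x)⁻¹ * phi d τ x y := by
  have h : Real.exp (f y) * Real.exp (-f y) = 1 := by rw [← Real.exp_add]; simp
  unfold qdens
  linear_combination (Z d τ f x)⁻¹ * phi d τ x y * h

theorem log_integral_exp_mul_qdens (d : ℕ) {τ : ℝ} (hτ : 0 < τ)
    (f : EuclideanSpace ℝ (Fin d) → ℝ) (x : EuclideanSpace ℝ (Fin d)) :
    Real.log (∫ y, Real.exp (f y) * qdens d τ f x y) = -Real.log (Z d τ f x) := by
  simp only [exp_mul_qdens]
  rw [integral_const_mul, integral_phi d hτ, mul_one, Real.log_inv]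

theorem log_phi_div_qdens (d : ℕ) {τ : ℝ} (hτ : 0 < τ) (f : EuclideanSpace ℝ (Fin d) → ℝ)
    (x xt y : EuclideanSpace ℝ (Fin d)) (hZ : 0 < Z d τ f xt) :
    Real.log (phi d τ x y / qdens d τ f xt y) =
      f y + Real.log (Z d τ f xt) + Real.log (phi d τ x y / phi d τ xt y) := by
  have h1 := phi_pos d hτ x y
  have h2 := phi_pos d hτ xt y
  unfold qdens
  rw [Real.log_div h1.ne' (by positivity), Real.log_mul (by positivity) (by positivity),
    Real.log_mul (by positivity) h2.ne', Real.log_inv, Real.log_exp,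
    Real.log_div h1.ne' h2.ne']
  ring

theorem sub_le_mul_log_div {a b : ℝ} (ha : 0 < a) (hb : 0 < b) :
    a - b ≤ a * Real.log (a / b) := by
  have h := mul_le_mul_of_nonneg_left (Real.one_sub_inv_le_log_of_pos (div_pos ha hb)) ha.le
  rwa [inv_div, mul_sub, mul_one, mul_div_cancel₀ _ ha.ne'] at h

theorem stmt12 (d : ℕ) (τ : ℝ) (hτ : 0 < τ)
    (f : EuclideanSpace ℝ (Fin d) → ℝ) (hf : Measurable f) (hfb : ∃ C, ∀ y, C ≤ f y)
    (hZint : ∀ y, Integrable (fun x' => Real.exp (-f x') * phi d τ y x'))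
    (hZpos : ∀ y, 0 < Z d τ f y) :
    (∀ x xt : EuclideanSpace ℝ (Fin d),
        Integrable (fun y => f y * phi d τ x y) →
        Integrable (fun y => Real.exp (f y) * qdens d τ f xt y) →
        Integrable (fun y => phi d τ x y * Real.log (phi d τ x y / qdens d τ f xt y)) →
        (∫ y, f y * phi d τ x y) ≤
          Real.log (∫ y, Real.exp (f y) * qdens d τ f xt y) +
            KL d (phi d τ x) (qdens d τ f xt)) ∧
    (∀ x : EuclideanSpace ℝ (Fin d),
        Integrable (fun y => f y * phi d τ x y) →
        Integrable (fun y => Real.exp (f y) * qdens d τ f x y) →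
        Integrable (fun y => phi d τ x y * Real.log (phi d τ x y / qdens d τ f x y)) →
        Real.log (∫ y, Real.exp (f y) * qdens d τ f x y) +
            KL d (phi d τ x) (qdens d τ f x) = ∫ y, f y * phi d τ x y) := by
  refine ⟨fun x xt hfx _ hKL => ?_, fun x hfx _ _ => ?_⟩
  · have hx := integrable_phi d hτ x
    have hxt := integrable_phi d hτ xt
    have hc := hx.const_mul (Real.log (Z d τ f xt))
    have hle : (∫ y, ((f y * phi d τ x y + Real.log (Z d τ f xt) * phi d τ x y) +
        (phi d τ x y - phi d τ xt y))) ≤ KL d (phi d τ x) (qdens d τ f xt) := by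
      refine integral_mono ((hfx.add hc).add (hx.sub hxt)) hKL fun y => ?_
      have h := sub_le_mul_log_div (phi_pos d hτ x y) (phi_pos d hτ xt y)
      simp only [log_phi_div_qdens d hτ f x xt y (hZpos xt)]
      linarith
    rw [integral_add (hfx.fun_add hc) (hx.sub hxt : Integrable fun y => phi d τ x y - phi d τ xt y), integral_add hfx hc, integral_sub hx hxt,
      integral_const_mul, integral_phi d hτ, integral_phi d hτ] at hle
    rw [log_integral_exp_mul_qdens d hτ]
    linarith
  · have hx := integrable_phi d hτ x
    have heq : KL d (phi d τ x) (qdens d τ f x) =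
        ∫ y, (f y * phi d τ x y + Real.log (Z d τ f x) * phi d τ x y) := by
      refine integral_congr_ae (.of_forall fun y => ?_)
      simp only [log_phi_div_qdens d hτ f x x y (hZpos x), div_self (phi_pos d hτ x y).ne',
        Real.log_one]
      ring
    rw [heq, integral_add hfx (hx.const_mul _), integral_const_mul, integral_phi d hτ,
      log_integral_exp_mul_qdens d hτ]
    ring
end
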